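/- Let K be a simplicial complex on the vertex set [m], and let (S¹)^K = { x ∈ (S¹)^m : there exists a face I ∈ K with x_k = 1 for all k ∉ I }. Then (S¹)^K is aspherical (i.e., it is path-connected and for every point x ∈ (S¹)^K and every n ≥ 2 the homotopy group π_n((S¹)^K, x) is trivial) if and only if K is a flag complex. -/

import Mathlib

/-- The polyhedral product `(S¹)^K ⊆ (S¹)^m`: the subspace of the `m`-torus consisting of
points `x` for which there is a face `I ∈ K` with `x_k = 1` for all `k ∉ I`. -/
abbrev circlePolyhedralProduct (m : ℕ) (K : Finset (Finset (Fin m))) : Type :=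
  { x : Fin m → Circle // ∃ I ∈ K, ∀ k, k ∉ I → x k = 1 }

section Miranda

open Finset

variable {ι : Type*} [DecidableEq ι]

/-- The mod 2 cubical cup product `dP_{j₁} ∪ ⋯ ∪ dP_{jᵣ}` of the coboundaries of the `0`-cochains
`P j`, evaluated on the cube with axes `S` and lowest vertex `z`. -/
def cupDiff (P : ι → (ι → ℕ) → ZMod 2) : List ι → Finset ι → (ι → ℕ) → ZMod 2
  | [], _, _ => 1
  | j :: l, S, z => ∑ i ∈ S, (P j (z + Pi.single i 1) - P j z) *
      cupDiff P l (S.erase i) (z + Pi.single i 1)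

/-- The mod 2 cubical coboundary. -/
def cubeCoboundary (α : Finset ι → (ι → ℕ) → ZMod 2) (S : Finset ι) (z : ι → ℕ) : ZMod 2 :=
  ∑ i ∈ S, (α (S.erase i) (z + Pi.single i 1) - α (S.erase i) z)

lemma sum_sum_erase_eq_zero (S : Finset ι) (g : ι → ι → ZMod 2) (hg : ∀ i k, g i k = g k i) :
    ∑ i ∈ S, ∑ k ∈ S.erase i, g i k = 0 := by
  rw [Finset.sum_sigma']
  refine Finset.sum_involution (fun x _ => ⟨x.2, x.1⟩) ?_ ?_ ?_ ?_
  · rintro ⟨i, k⟩ _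
    simp only [hg i k]
    exact CharTwo.add_self_eq_zero _
  · rintro ⟨i, k⟩ h _ heq
    simp only [mem_sigma, mem_erase] at h
    simp only [Sigma.mk.injEq] at heq
    exact h.2.1 heq.1
  · rintro ⟨i, k⟩ h
    simp only [mem_sigma, mem_erase] at h ⊢
    exact ⟨h.2.2, Ne.symm h.2.1, h.1⟩
  · rintro ⟨i, k⟩ _
    rfl

lemma cubeCoboundary_cubeCoboundary (α : Finset ι → (ι → ℕ) → ZMod 2) (S : Finset ι)
    (z : ι → ℕ) : cubeCoboundary (cubeCoboundary α) S z = 0 := by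
  unfold cubeCoboundary
  simp only [← Finset.sum_sub_distrib]
  refine sum_sum_erase_eq_zero S (fun i k => α ((S.erase i).erase k) (z + Pi.single i 1 +
    Pi.single k 1) - α ((S.erase i).erase k) (z + Pi.single i 1) -
    (α ((S.erase i).erase k) (z + Pi.single k 1) - α ((S.erase i).erase k) z)) fun i k => ?_
  simp only [Finset.erase_right_comm (a := i) (b := k), add_right_comm z (Pi.single i 1)]
  ring

lemma cubeCoboundary_mul_cupDiff (P : ι → (ι → ℕ) → ZMod 2) (l : List ι)
    (hl : ∀ S z, cubeCoboundary (cupDiff P l) S z = 0) (j : ι) (S : Finset ι) (z : ι → ℕ) :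
    cupDiff P (j :: l) S z = cubeCoboundary (fun S z => P j z * cupDiff P l S z) S z := by
  have h := congrArg (P j z * ·) (hl S z)
  simp only [cubeCoboundary, mul_zero, Finset.mul_sum] at h
  simp only [cupDiff, cubeCoboundary]
  rw [← add_zero (∑ i ∈ S, _), ← h, ← Finset.sum_add_distrib]
  exact Finset.sum_congr rfl fun i _ => by ring

lemma cubeCoboundary_cupDiff (P : ι → (ι → ℕ) → ZMod 2) (l : List ι) (S : Finset ι)
    (z : ι → ℕ) : cubeCoboundary (cupDiff P l) S z = 0 := by
  induction l generalizing S z with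
  | nil => simp [cubeCoboundary, cupDiff]
  | cons j l ih =>
    have : cupDiff P (j :: l) = cubeCoboundary (fun S z => P j z * cupDiff P l S z) := by
      funext S z
      exact cubeCoboundary_mul_cupDiff P l ih j S z
    rw [this, cubeCoboundary_cubeCoboundary]

lemma cupDiff_eq_zero (P : ι → (ι → ℕ) → ZMod 2) (l : List ι) (S : Finset ι) (z : ι → ℕ)
    (i : ι) (hi : i ∈ l) (c : ZMod 2)
    (h : ∀ w, (∀ a ∈ S, z a ≤ w a ∧ w a ≤ z a + 1) → (∀ a ∉ S, w a = z a) → P i w = c) :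
    cupDiff P l S z = 0 := by
  induction l generalizing S z with
  | nil => simp at hi
  | cons j l ih =>
    refine Finset.sum_eq_zero fun k hk => ?_
    rcases List.mem_cons.1 hi with rfl | hi
    · rw [h z (by simp) (by simp), h (z + Pi.single k 1), sub_self, zero_mul]
      · intro a _
        by_cases hak : a = k
        · subst hak; simp
        · simp [hak]
      · intro a ha
        have : a ≠ k := by rintro rfl; exact ha hk
        simp [this]
    · rw [ih _ _ hi, mul_zero]
      intro w hw hw'
      refine h w (fun a ha => ?_) (fun a ha => ?_)
      · by_cases hak : a = k
        · subst hak
          have := hw' a (by simp)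
          simp at this
          omega
        · simpa [hak] using hw a (by simp [hak, ha])
      · have : a ≠ k := by rintro rfl; exact ha hk
        simpa [this] using hw' a (by simp [ha])

/-- The lattice points of the part of the cube `[0, n]^ι` on which the coordinates outside `S` are
equal to `n`. -/
def latticeBox [Fintype ι] (n : ℕ) (S : Finset ι) : Finset (ι → ℕ) :=
  Fintype.piFinset fun i => if i ∈ S then range n else {n}

lemma sum_latticeBox_sub [Fintype ι] (n : ℕ) (S : Finset ι) (i : ι) (hi : i ∈ S)
    (α : (ι → ℕ) → ZMod 2) :
    ∑ z ∈ latticeBox n S, (α (z + Pi.single i 1) - α z) =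
      ∑ z ∈ latticeBox n (S.erase i), (α z - α (Function.update z i 0)) := by
  have key : ∀ z ∈ latticeBox n (S.erase i), α z - α (Function.update z i 0) =
      ∑ t ∈ range n, (α (Function.update z i t + Pi.single i 1) - α (Function.update z i t)) := by
    intro z hz
    have hzi : z i = n := by
      have := Fintype.mem_piFinset.1 hz i
      simpa using this
    have : ∀ t, Function.update z i t + Pi.single i 1 = Function.update z i (t + 1) := by
      intro t
      funext a
      by_cases ha : a = i
      · subst ha; simp
      · simp [ha]
    simp only [this]
    rw [Finset.sum_range_sub (fun t => α (Function.update z i t)), ← hzi, Function.update_eq_self]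
  rw [Finset.sum_congr rfl key, Finset.sum_sigma']
  refine Finset.sum_bij' (fun z _ => ⟨Function.update z i n, z i⟩)
    (fun x _ => Function.update x.1 i x.2) ?_ ?_ ?_ ?_ ?_
  · intro z hz
    have hz' := Fintype.mem_piFinset.1 hz
    simp only [mem_sigma]
    refine ⟨Fintype.mem_piFinset.2 fun a => ?_, by simpa [hi] using hz' i⟩
    by_cases ha : a = i
    · subst ha; simp
    · simpa [ha] using hz' a
  · rintro ⟨z, t⟩ hz
    simp only [mem_sigma] at hz
    have hz' := Fintype.mem_piFinset.1 hz.1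
    refine Fintype.mem_piFinset.2 fun a => ?_
    by_cases ha : a = i
    · subst ha; simpa [hi] using hz.2
    · simpa [ha] using hz' a
  · intro z _
    simp
  · rintro ⟨z, t⟩ hz
    simp only [mem_sigma] at hz
    have hzi : z i = n := by
      have := Fintype.mem_piFinset.1 hz.1 i
      simpa using this
    simp [← hzi]
  · intro z _
    simp

lemma sum_cupDiff [Fintype ι] (n : ℕ) (P : ι → (ι → ℕ) → ZMod 2)
    (h0 : ∀ i z, z i = 0 → P i z = 0) (h1 : ∀ i z, z i = n → P i z = 1)
    (l : List ι) (hl : l.Nodup) :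
    ∑ z ∈ latticeBox n l.toFinset, cupDiff P l l.toFinset z = 1 := by
  induction l with
  | nil => simp [latticeBox, cupDiff]
  | cons j l ih =>
    obtain ⟨hj, hl⟩ := List.nodup_cons.1 hl
    set S := (j :: l).toFinset with hS
    have hSj : S.erase j = l.toFinset := by
      rw [hS, List.toFinset_cons, Finset.erase_insert (by simpa using hj)]
    have hjS : j ∈ S := by simp [hS]
    have hn : ∀ i z, z ∈ latticeBox n (S.erase i) → z i = n := by
      intro i z hz
      have := Fintype.mem_piFinset.1 hz i
      simpa using this
    calc ∑ z ∈ latticeBox n S, cupDiff P (j :: l) S z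
        = ∑ i ∈ S, ∑ z ∈ latticeBox n (S.erase i),
            (P j z * cupDiff P l (S.erase i) z - P j (Function.update z i 0) *
              cupDiff P l (S.erase i) (Function.update z i 0)) := by
          simp only [cubeCoboundary_mul_cupDiff P l (cubeCoboundary_cupDiff P l), cubeCoboundary]
          rw [Finset.sum_comm]
          exact Finset.sum_congr rfl fun i hi =>
            sum_latticeBox_sub n S i hi fun z => P j z * cupDiff P l (S.erase i) z
      _ = ∑ z ∈ latticeBox n (S.erase j),
            (P j z * cupDiff P l (S.erase j) z - P j (Function.update z j 0) *
              cupDiff P l (S.erase j) (Function.update z j 0)) := by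
          refine Finset.sum_eq_single_of_mem j hjS fun i hi hij => ?_
          have hil : i ∈ l := by simpa [hS, hij] using hi
          refine Finset.sum_eq_zero fun z hz => ?_
          rw [cupDiff_eq_zero P l _ z i hil 1,
            cupDiff_eq_zero P l _ (Function.update z i 0) i hil 0]
          · simp
          · intro w _ hw
            exact h0 i w (by simpa using hw i (by simp))
          · intro w _ hw
            exact h1 i w (by rw [hw i (by simp), hn i z hz])
      _ = ∑ z ∈ latticeBox n l.toFinset, cupDiff P l l.toFinset z := by
          rw [hSj]
          refine Finset.sum_congr rfl fun z hz => ?_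
          rw [h1 j z (hn j z (hSj ▸ hz)), h0 j (Function.update z j 0) (by simp)]
          simp
      _ = 1 := ih hl

/-- A cubical form of Sperner's lemma. -/
lemma exists_cube_changing [Fintype ι] (n : ℕ) (P : ι → (ι → ℕ) → Prop)
    (h0 : ∀ i z, z i = 0 → ¬ P i z) (h1 : ∀ i z, z i = n → P i z) :
    ∃ z : ι → ℕ, (∀ i, z i < n) ∧ ∀ i, (∃ w, (∀ a, z a ≤ w a ∧ w a ≤ z a + 1) ∧ P i w) ∧
      ∃ w, (∀ a, z a ≤ w a ∧ w a ≤ z a + 1) ∧ ¬ P i w := by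
  classical
  have hsum := sum_cupDiff n (fun i z => if P i z then 1 else 0) (fun i z h => by simp [h0 i z h])
    (fun i z h => by simp [h1 i z h]) (Finset.univ : Finset ι).toList (Finset.nodup_toList _)
  rw [Finset.toList_toFinset] at hsum
  obtain ⟨z, hz, hne⟩ := Finset.exists_ne_zero_of_sum_ne_zero (hsum ▸ one_ne_zero)
  refine ⟨z, fun i => by simpa using Fintype.mem_piFinset.1 hz i, fun i => ⟨?_, ?_⟩⟩
  · by_contra! hcon
    exact hne (cupDiff_eq_zero _ _ _ _ i (by simp) 0 fun w hw _ => by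
      simp [hcon w fun a => hw a (Finset.mem_univ a)])
  · by_contra! hcon
    exact hne (cupDiff_eq_zero _ _ _ _ i (by simp) 1 fun w hw _ => by
      simp [hcon w fun a => hw a (Finset.mem_univ a)])

/-- The **Poincaré–Miranda theorem** on the unit cube. -/
theorem poincare_miranda [Fintype ι] (f : (ι → ℝ) → ι → ℝ) (hf : Continuous f)
    (h0 : ∀ i x, x ∈ Set.Icc (0 : ι → ℝ) 1 → x i = 0 → f x i ≤ 0)
    (h1 : ∀ i x, x ∈ Set.Icc (0 : ι → ℝ) 1 → x i = 1 → 0 < f x i) :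
    ∃ x ∈ Set.Icc (0 : ι → ℝ) 1, f x = 0 := by
  by_contra! hcon
  have hcomp : IsCompact (Set.Icc (0 : ι → ℝ) 1) := isCompact_Icc
  obtain ⟨ε, hε, hεf⟩ : ∃ ε > 0, ∀ x ∈ Set.Icc (0 : ι → ℝ) 1, ε ≤ ‖f x‖ := by
    obtain ⟨x0, hx0, hmin⟩ := hcomp.exists_isMinOn ⟨0, by simp⟩ (hf.norm.continuousOn)
    exact ⟨‖f x0‖, norm_pos_iff.2 (hcon x0 hx0), fun x hx => hmin hx⟩
  obtain ⟨δ, hδ, hδf⟩ := Metric.uniformContinuousOn_iff.1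
    (hcomp.uniformContinuousOn_of_continuous hf.continuousOn) ε hε
  obtain ⟨n, hn⟩ := exists_nat_one_div_lt hδ
  have hn' : (0 : ℝ) < (n + 1 : ℕ) := by positivity
  let q : (ι → ℕ) → ι → ℝ := fun w a => min ((w a : ℝ) / (n + 1 : ℕ)) 1
  have hq : ∀ w, q w ∈ Set.Icc (0 : ι → ℝ) 1 := fun w =>
    ⟨fun a => le_min (by positivity) zero_le_one, fun a => min_le_right _ _⟩
  obtain ⟨z, hz, hzP⟩ := exists_cube_changing (n + 1) (fun i w => 0 < f (q w) i)
    (fun i w h => not_lt.2 (h0 i _ (hq w) (by simp [q, h])))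
    (fun i w h => h1 i _ (hq w) (by simp only [q, h]; rw [div_self hn'.ne', min_self]))
  have hclose : ∀ w : ι → ℕ, (∀ a, z a ≤ w a ∧ w a ≤ z a + 1) → dist (q z) (q w) < δ := by
    intro w hw
    refine lt_of_le_of_lt ((dist_pi_le_iff (by positivity)).2 fun a => ?_) hn
    have e1 : q z a = (z a : ℝ) / (n + 1 : ℕ) := min_eq_left (by
      rw [div_le_one hn']; exact_mod_cast (hz a).le)
    have e2 : q w a = (w a : ℝ) / (n + 1 : ℕ) := min_eq_left (by
      rw [div_le_one hn']; exact_mod_cast (hw a).2.trans (hz a))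
    rw [e1, e2, Real.dist_eq, ← sub_div, abs_div, abs_of_pos hn']
    push_cast
    gcongr
    rw [abs_sub_comm, abs_of_nonneg (sub_nonneg.2 (by exact_mod_cast (hw a).1))]
    have : (w a : ℝ) ≤ z a + 1 := by exact_mod_cast (hw a).2
    linarith
  have hcoord : ∀ w : ι → ℕ, (∀ a, z a ≤ w a ∧ w a ≤ z a + 1) → ∀ i,
      |f (q z) i - f (q w) i| < ε := fun w hw i =>
    lt_of_le_of_lt (dist_le_pi_dist (f (q z)) (f (q w)) i) (hδf _ (hq z) _ (hq w) (hclose w hw))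
  have hlt : ‖f (q z)‖ < ε := by
    rw [pi_norm_lt_iff hε]
    intro i
    obtain ⟨⟨w, hw, hpos⟩, w', hw', hneg⟩ := hzP i
    have h1 := abs_lt.1 (hcoord w hw i)
    have h2 := abs_lt.1 (hcoord w' hw' i)
    rw [Real.norm_eq_abs, abs_lt]
    constructor <;> linarith
  exact absurd (hεf _ (hq z)) (not_le.2 hlt)

end Miranda

section Obstruction
open unitInterval
open scoped Topology.Homotopy

/-- The scaling factor of the model map on the cube. -/
noncomputable def bumpScale (r : ℝ) : ℝ := max 0 (min 1 (3 - 3 * r)) / max r (1 / 3)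

/-- The height of the model map on the cube. -/
noncomputable def bumpHeight (r : ℝ) : ℝ := max (-1) (min 1 (3 - 6 * r))

/-- The model map from a cube `[-1, 1]^κ` to the boundary of the cube `[-1, 1]^(Option κ)`, which
collapses the boundary of the cube to a point. -/
noncomputable def bump {κ : Type*} [Fintype κ] (y : κ → ℝ) : Option κ → ℝ
  | some i => bumpScale ‖y‖ * y i
  | none => bumpHeight ‖y‖

theorem continuous_bump {κ : Type*} [Fintype κ] : Continuous (bump : (κ → ℝ) → Option κ → ℝ) := by
  refine continuous_pi fun a => ?_
  cases a with
  | none => simp only [bump, bumpHeight]; fun_prop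
  | some i =>
    simp only [bump, bumpScale]
    refine (Continuous.div ?_ ?_ fun y => ?_).mul (by fun_prop)
    · fun_prop
    · fun_prop
    · exact (lt_max_of_lt_right (by norm_num)).ne'

/-- The base point of the model map. -/
def bumpBase (κ : Type*) : Option κ → ℝ
  | some _ => 0
  | none => -1

theorem bump_of_norm_eq_one {κ : Type*} [Fintype κ] {y : κ → ℝ} (hy : ‖y‖ = 1) :
    bump y = bumpBase κ := by
  funext a
  cases a with
  | none => simp only [bump, bumpHeight, bumpBase, hy]; norm_num
  | some i => simp only [bump, bumpScale, bumpBase, hy]; norm_num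

theorem exists_abs_eq_norm {κ : Type*} [Fintype κ] {y : κ → ℝ} (hy : 0 < ‖y‖) :
    ∃ i, |y i| = ‖y‖ := by
  by_contra! h
  have := (pi_norm_lt_iff hy).2 fun i => lt_of_le_of_ne (norm_le_pi_norm y i) (h i)
  exact lt_irrefl _ this

theorem exists_abs_bump_eq_one {κ : Type*} [Fintype κ] (y : κ → ℝ) :
    ∃ a, |bump y a| = 1 := by
  rcases le_or_gt ‖y‖ (1 / 3) with h | h
  · refine ⟨none, ?_⟩
    have : (1 : ℝ) ≤ 3 - 6 * ‖y‖ := by linarith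
    simp [bump, bumpHeight, min_eq_left this]
  rcases le_or_gt ‖y‖ (2 / 3) with h' | h'
  · obtain ⟨i, hi⟩ := exists_abs_eq_norm (y := y) (by linarith)
    refine ⟨some i, ?_⟩
    have h1 : (1 : ℝ) ≤ 3 - 3 * ‖y‖ := by linarith
    have h2 : ‖y‖ ≠ 0 := by linarith
    have h3 : (3 : ℝ)⁻¹ ≤ ‖y‖ := by linarith
    simp [bump, bumpScale, min_eq_left h1, max_eq_left h3, abs_mul, hi, h2]
  · refine ⟨none, ?_⟩
    have h1 : 3 - 6 * ‖y‖ ≤ -1 := by linarith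
    have h2 : min 1 (3 - 6 * ‖y‖) ≤ -1 := min_le_of_right_le h1
    simp [bump, bumpHeight, max_eq_left h2]

/-- The affine map from `[-1, 1]` to the unit interval, extended to the line. -/
noncomputable def toUnit (s : ℝ) : I := Set.projIcc 0 1 zero_le_one ((s + 1) / 2)

theorem continuous_toUnit : Continuous toUnit :=
  continuous_projIcc.comp (by fun_prop)

theorem coe_toUnit {s : ℝ} (hs : |s| ≤ 1) : (toUnit s : ℝ) = (s + 1) / 2 := by
  rw [abs_le] at hs
  rw [toUnit, Set.projIcc_of_mem zero_le_one ⟨by linarith, by linarith⟩]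

/-- The model map on the unit cube is not nullhomotopic relative to the boundary through maps that
avoid the origin. -/
theorem not_nullhomotopic_bump {κ : Type*} [Fintype κ] [DecidableEq κ]
    (G : I × (κ → I) → Option κ → ℝ) (hG : Continuous G)
    (h0 : ∀ y, G (0, y) = bump fun i => 2 * (y i : ℝ) - 1)
    (h1 : ∀ y, G (1, y) = bumpBase κ)
    (hb : ∀ t, ∀ y ∈ Cube.boundary κ, G (t, y) = bumpBase κ)
    (hne : ∀ p, G p ≠ 0) : False := by
  set c : (Option κ → ℝ) → Option κ → ℝ := fun z a => z a / max ‖z‖ 1 with hc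
  have hcc : Continuous c := by
    refine continuous_pi fun a => Continuous.div (by fun_prop) (by fun_prop) fun z => ?_
    exact (lt_max_of_lt_right one_pos).ne'
  set l : (Option κ → ℝ) → ℝ := fun z => max 0 (min 1 (‖z‖ - 1)) with hl
  have hlc : Continuous l := by fun_prop
  set D : (Option κ → ℝ) → Option κ → ℝ :=
    fun z => G (toUnit (-(z none)), fun i => toUnit (z (some i))) with hD
  have hDc : Continuous D := by
    refine hG.comp (Continuous.prodMk ?_ ?_)
    · exact continuous_toUnit.comp (by fun_prop)
    · exact continuous_pi fun i => continuous_toUnit.comp (by fun_prop)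
  set M : (Option κ → ℝ) → Option κ → ℝ := fun z a => (1 - l z) * D (c z) a + l z * c z a with hM
  have hMc : Continuous M := by
    refine continuous_pi fun a => ?_
    have e1 := (continuous_apply a).comp (hDc.comp hcc)
    have e2 := (continuous_apply a).comp hcc
    exact ((continuous_const.sub hlc).mul e1).add (hlc.mul e2)
  have hcle : ∀ z a, |c z a| ≤ 1 := by
    intro z a
    have h : (0 : ℝ) < max ‖z‖ 1 := lt_max_of_lt_right one_pos
    simp only [hc, abs_div, abs_of_pos h]
    rw [div_le_one h]
    exact (norm_le_pi_norm z a).trans (le_max_left _ _)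
  have hl1 : ∀ z, l z ≤ 1 := fun z => max_le zero_le_one (min_le_left _ _)
  have hMne : ∀ z, M z ≠ 0 := by
    intro z hz
    have hz' : ∀ a, (1 - l z) * D (c z) a + l z * c z a = 0 := fun a => congrFun hz a
    rcases le_or_gt ‖z‖ 1 with hle | hgt
    · have : l z = 0 := by
        simp only [hl]
        exact max_eq_left (min_le_of_right_le (by linarith))
      refine hne (toUnit (-(c z none)), fun i => toUnit (c z (some i))) (funext fun a => ?_)
      have := hz' a
      simp only [‹l z = 0›] at this
      simpa using this
    have hlpos : 0 < l z := lt_max_of_lt_right (lt_min one_pos (by linarith))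
    obtain ⟨a, ha⟩ := exists_abs_eq_norm (y := z) (by linarith)
    have ha1 : |c z a| = 1 := by
      have h : (0 : ℝ) < max ‖z‖ 1 := lt_max_of_lt_right one_pos
      simp only [hc, abs_div, abs_of_pos h, ha]
      rw [max_eq_left hgt.le, div_self (by linarith)]
    have key : D (c z) = bumpBase κ → False := by
      intro hbase
      have e1 : ∀ i, c z (some i) = 0 := by
        intro i
        have := hz' (some i)
        rw [hbase] at this
        simpa [bumpBase, hlpos.ne'] using this
      have e2 := hz' none
      rw [hbase] at e2
      simp only [bumpBase] at e2
      cases a with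
      | some i => rw [e1 i] at ha1; norm_num at ha1
      | none =>
        rcases abs_eq_abs.1 (ha1.trans abs_one.symm) with h | h
        · have e4 : toUnit (-(c z none)) = 0 := Subtype.ext (by
            rw [coe_toUnit (by simpa using hcle z none), h]; norm_num)
          have e5 : (fun i => 2 * ((fun i => toUnit (c z (some i))) i : ℝ) - 1) = (0 : κ → ℝ) := by
            funext i
            simp only [coe_toUnit (hcle z (some i)), Pi.zero_apply]
            rw [e1 i]; norm_num
          have e6 : D (c z) none = 1 := by
            simp only [hD]
            rw [e4, h0, e5]
            simp [bump, bumpHeight]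
          rw [hbase] at e6
          simp only [bumpBase] at e6
          norm_num at e6
        · rw [h] at e2; linarith
    cases a with
    | some i =>
      refine key (hb _ _ ⟨i, ?_⟩)
      rcases abs_eq_abs.1 (ha1.trans abs_one.symm) with h | h
      · exact Or.inr (Subtype.ext (by rw [coe_toUnit (hcle z _), h]; norm_num))
      · exact Or.inl (Subtype.ext (by rw [coe_toUnit (hcle z _), h]; norm_num))
    | none =>
      rcases abs_eq_abs.1 (ha1.trans abs_one.symm) with h | h
      · have e4 : toUnit (-(c z none)) = 0 := Subtype.ext (by
          rw [coe_toUnit (by simpa using hcle z none), h]; norm_num)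
        have e5 : (fun i => 2 * ((fun i => toUnit (c z (some i))) i : ℝ) - 1)
            = fun i => c z (some i) := by
          funext i
          simp only [coe_toUnit (hcle z _)]; ring
        have e6 : D (c z) = bump fun i => c z (some i) := by
          simp only [hD]
          rw [e4, h0, e5]
        have e7 : ∀ i, c z (some i) = 0 := by
          intro i
          have h' := hz' (some i)
          rw [e6] at h'
          simp only [bump] at h'
          have h2 : 0 ≤ bumpScale ‖fun i => c z (some i)‖ := by
            unfold bumpScale; positivity
          have h3 : ((1 - l z) * bumpScale ‖fun i => c z (some i)‖ + l z) * c z (some i) = 0 := by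
            linarith
          refine (mul_eq_zero.1 h3).resolve_left ?_
          have := mul_nonneg (sub_nonneg.2 (hl1 z)) h2
          linarith
        have h' := hz' none
        have e8 : (fun i => c z (some i)) = 0 := funext e7
        rw [e6, e8, h] at h'
        simp [bump, bumpHeight] at h'
      · refine key ?_
        have : toUnit (-(c z none)) = 1 := Subtype.ext (by
          rw [coe_toUnit (by simpa using hcle z none), h]; norm_num)
        simp only [hD]
        rw [this, h1]
  have hface : ∀ (x : Option κ → ℝ) a, x ∈ Set.Icc (0 : Option κ → ℝ) 1 → |4 * x a - 2| = 2 →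
      M (fun a => 4 * x a - 2) a = (4 * x a - 2) / 2 := by
    intro x a hx ha
    have hn : ‖fun a => 4 * x a - 2‖ = 2 := by
      refine le_antisymm ((pi_norm_le_iff_of_nonneg (by norm_num)).2 fun b => ?_) ?_
      · have h1 := hx.1 b
        have h2 := hx.2 b
        simp only [Pi.zero_apply, Pi.one_apply] at h1 h2
        rw [Real.norm_eq_abs, abs_le]
        constructor <;> linarith
      · exact ha.ge.trans (norm_le_pi_norm (fun a => 4 * x a - 2) a)
    have h1 : l (fun a => 4 * x a - 2) = 1 := by
      simp only [hl, hn]; norm_num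
    have h2 : (max 2 1 : ℝ) = 2 := by norm_num
    simp only [hM, h1, hc, hn, h2]
    ring
  obtain ⟨x, -, hx⟩ := poincare_miranda (fun x : Option κ → ℝ => M fun a => 4 * x a - 2)
    (hMc.comp (by fun_prop))
    (fun a x hx ha => by
      have := hface x a hx (by rw [ha]; norm_num)
      simp only [this, ha]; norm_num)
    (fun a x hx ha => by
      have := hface x a hx (by rw [ha]; norm_num)
      simp only [this, ha]; norm_num)
  exact hMne _ hx

end Obstruction

section FlagOfAspherical
open unitInterval
open scoped Topology.Homotopy

theorem circle_exp_pi_mul_eq_one_of_abs_eq_one {s : ℝ} (hs : |s| = 1) :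
    Circle.exp (Real.pi * (s + 1)) = 1 := by
  rcases abs_eq_abs.1 (hs.trans abs_one.symm) with h | h
  · rw [h, show Real.pi * (1 + 1) = 2 * Real.pi by ring, Circle.exp_two_pi]
  · rw [h]; norm_num

theorem circle_exp_pi_ne_one : Circle.exp Real.pi ≠ 1 := by
  intro h
  rw [← Circle.exp_zero, Circle.exp_eq_exp] at h
  obtain ⟨k, hk⟩ := h
  have h1 : Real.pi * (1 - 2 * k) = 0 := by linarith
  have h2 := (mul_eq_zero.1 h1).resolve_left Real.pi_ne_zero
  have h3 : (1 : ℤ) - 2 * k = 0 := by exact_mod_cast h2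
  omega

/-- A minimal missing face with at least three vertices yields a nontrivial higher homotopy
group of the polyhedral product. -/
theorem exists_not_subsingleton_homotopyGroup (m : ℕ) (K : Finset (Finset (Fin m)))
    (hdown : ∀ L ∈ K, ∀ J ⊆ L, J ∈ K) (J : Finset (Fin m)) (hJ : J ∉ K)
    (hproper : ∀ L, L ⊂ J → L ∈ K) (n : ℕ) (hn : 0 < n) (hcard : J.card = n + 1) :
    ∃ x : circlePolyhedralProduct m K,
      ¬ Subsingleton (HomotopyGroup (Fin n) (circlePolyhedralProduct m K) x) := by
  classical
  have e : Option (Fin n) ≃ J := Fintype.equivOfCardEq (by simp [hcard])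
  set P : (Option (Fin n) → ℝ) → Fin m → Circle := fun h k =>
    if hk : k ∈ J then Circle.exp (Real.pi * (h (e.symm ⟨k, hk⟩) + 1)) else 1 with hP
  have hPc : Continuous P := by
    refine continuous_pi fun k => ?_
    by_cases hk : k ∈ J
    · simp only [hP, hk, dif_pos]
      exact Circle.exp.continuous.comp (by fun_prop)
    · simp only [hP, hk, dif_neg, not_false_iff]
      exact continuous_const
  have hPe : ∀ h a, P h (e a) = Circle.exp (Real.pi * (h a + 1)) := by
    intro h a
    simp [hP]
  have hPm : ∀ h : Option (Fin n) → ℝ, (∃ a, |h a| = 1) → ∃ L ∈ K, ∀ k, k ∉ L → P h k = 1 := by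
    rintro h ⟨a, ha⟩
    refine ⟨J.erase (e a), hproper _ (Finset.erase_ssubset (e a).2), fun k hk => ?_⟩
    by_cases hkJ : k ∈ J
    · have : k = e a := by
        by_contra hne
        exact hk (Finset.mem_erase.2 ⟨hne, hkJ⟩)
      rw [this, hPe]
      exact circle_exp_pi_mul_eq_one_of_abs_eq_one ha
    · simp [hP, hkJ]
  have hbase : ∃ a, |bumpBase (Fin n) a| = 1 := ⟨none, by simp [bumpBase]⟩
  set c : (Fin n → I) → Fin n → ℝ := fun y i => 2 * (y i : ℝ) - 1 with hc
  have hcc : Continuous c := by fun_prop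
  have hcb : ∀ y ∈ Cube.boundary (Fin n), bump (c y) = bumpBase (Fin n) := by
    rintro y ⟨i, hi⟩
    refine bump_of_norm_eq_one (le_antisymm ?_ ?_)
    · refine (pi_norm_le_iff_of_nonneg zero_le_one).2 fun j => ?_
      have h1 := (y j).2.1
      have h2 := (y j).2.2
      rw [Real.norm_eq_abs, abs_le]
      constructor <;> simp only [hc] <;> linarith
    · refine le_trans (le_of_eq ?_) (norm_le_pi_norm (c y) i)
      rcases hi with hi | hi <;> simp [hc, hi]
      norm_num
  refine ⟨⟨P (bumpBase (Fin n)), hPm _ hbase⟩, fun hsub => ?_⟩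
  let g : GenLoop (Fin n) (circlePolyhedralProduct m K) ⟨P (bumpBase (Fin n)), hPm _ hbase⟩ :=
    ⟨⟨fun y => ⟨P (bump (c y)), hPm _ (exists_abs_bump_eq_one _)⟩,
      (hPc.comp (continuous_bump.comp hcc)).subtype_mk _⟩,
      fun y hy => Subtype.ext (by simp only [ContinuousMap.coe_mk, hcb y hy])⟩
  have hg : GenLoop.Homotopic g GenLoop.const :=
    Quotient.exact (s := GenLoop.Homotopic.setoid _ _)
      (Subsingleton.elim (α := HomotopyGroup (Fin n) (circlePolyhedralProduct m K) _)
        (Quotient.mk _ g) (Quotient.mk _ GenLoop.const))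
  obtain ⟨H⟩ := hg
  have hHc : Continuous fun p : I × (Fin n → I) => (H p).1 :=
    continuous_subtype_val.comp H.continuous
  have hH0 : ∀ y, (H (0, y)).1 = P (bump (c y)) := fun y => by rw [H.apply_zero]; rfl
  have hH1 : ∀ y, (H (1, y)).1 = P (bumpBase (Fin n)) := fun y => by rw [H.apply_one]; rfl
  have hHb : ∀ t, ∀ y ∈ Cube.boundary (Fin n), (H (t, y)).1 = P (bumpBase (Fin n)) :=
    fun t y hy => by
      rw [H.eq_fst t hy]
      change P (bump (c y)) = _
      rw [hcb y hy]
  set Ha : Option (Fin n) → C(I × (Fin n → I), Circle) := fun a =>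
    ⟨fun p => (H p).1 (e a), (continuous_apply (e a : Fin m)).comp hHc⟩
  set fa : Option (Fin n) → C(Fin n → I, ℝ) := fun a =>
    ⟨fun y => Real.pi * (bump (c y) a + 1),
      continuous_const.mul ((((continuous_apply a).comp
        (continuous_bump.comp hcc))).add continuous_const)⟩ with hfa
  have hstart : ∀ a y, Ha a (0, y) = Circle.exp (fa a y) := fun a y => by
    change (H (0, y)).1 (e a) = _
    rw [hH0, hPe]; rfl
  set th := fun a => Circle.isCoveringMap_exp.liftHomotopy (Ha a) (fa a) (hstart a)
  have hlift : ∀ a p, Circle.exp (th a p) = (H p).1 (e a) := fun a p =>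
    congrFun (Circle.isCoveringMap_exp.liftHomotopy_lifts (Ha a) (fa a) (hstart a)) p
  have hzero : ∀ a y, th a (0, y) = fa a y := fun a y =>
    Circle.isCoveringMap_exp.liftHomotopy_zero (Ha a) (fa a) (hstart a) y
  have hbd : ∀ a t, ∀ y ∈ Cube.boundary (Fin n),
      th a (t, y) = Real.pi * (bumpBase (Fin n) a + 1) := by
    intro a t y hy
    have := Circle.isCoveringMap_exp.const_of_comp (g := fun t : I => th a (t, y))
      (by fun_prop) (fun t t' => by simp only [hlift, hHb _ y hy]) t 0
    rw [this, hzero]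
    simp only [hfa, ContinuousMap.coe_mk, hcb y hy]
  have hone : ∀ a y, th a (1, y) = Real.pi * (bumpBase (Fin n) a + 1) := by
    intro a y
    have := Circle.isCoveringMap_exp.const_of_comp (g := fun y : Fin n → I => th a (1, y))
      (by fun_prop) (fun y y' => by simp only [hlift, hH1]) y 0
    rw [this]
    exact hbd a 1 0 ⟨⟨0, hn⟩, Or.inl rfl⟩
  refine not_nullhomotopic_bump (fun p a => th a p / Real.pi - 1) ?_ ?_ ?_ ?_ ?_
  · exact continuous_pi fun a => ((th a).continuous.div_const _).sub continuous_const
  · intro y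
    funext a
    simp only [hzero, hfa, ContinuousMap.coe_mk]
    field_simp [Real.pi_ne_zero]
    simp [hc]
  · intro y
    funext a
    simp only [hone]
    field_simp [Real.pi_ne_zero]
    ring
  · intro t y hy
    funext a
    simp only [hbd a t y hy]
    field_simp [Real.pi_ne_zero]
    ring
  · intro p hp
    obtain ⟨L, hL, hLk⟩ := (H p).2
    refine hJ (hdown L hL J fun k hk => ?_)
    by_contra hkL
    have h1 := hlift (e.symm ⟨k, hk⟩) p
    simp only [Equiv.apply_symm_apply] at h1
    rw [hLk k hkL] at h1
    have h2 : th (e.symm ⟨k, hk⟩) p / Real.pi - 1 = 0 := congrFun hp _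
    have h3 : th (e.symm ⟨k, hk⟩) p = Real.pi := by
      field_simp [Real.pi_ne_zero] at h2
      linarith
    rw [h3] at h1
    exact circle_exp_pi_ne_one h1

theorem flag_of_subsingleton_homotopyGroup (m : ℕ) (K : Finset (Finset (Fin m)))
    (hdown : ∀ L ∈ K, ∀ J ⊆ L, J ∈ K) (hempty : (∅ : Finset (Fin m)) ∈ K)
    (hsingle : ∀ i : Fin m, ({i} : Finset (Fin m)) ∈ K)
    (hsub : ∀ (x : circlePolyhedralProduct m K) (n : ℕ), 2 ≤ n →
      Subsingleton (HomotopyGroup (Fin n) (circlePolyhedralProduct m K) x))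
    (J : Finset (Fin m)) (hJ : ∀ i ∈ J, ∀ j ∈ J, i ≠ j → ({i, j} : Finset (Fin m)) ∈ K) :
    J ∈ K := by
  induction J using Finset.strongInduction with
  | H J ih =>
    by_contra hJK
    have hproper : ∀ L, L ⊂ J → L ∈ K := fun L hL =>
      ih L hL fun i hi j hj => hJ i (hL.1 hi) j (hL.1 hj)
    have hcard : 2 < J.card := by
      by_contra! hle
      interval_cases h : J.card
      · rw [Finset.card_eq_zero] at h
        exact hJK (h ▸ hempty)
      · obtain ⟨i, rfl⟩ := Finset.card_eq_one.1 h
        exact hJK (hsingle i)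
      · obtain ⟨i, j, hij, rfl⟩ := Finset.card_eq_two.1 h
        exact hJK (hJ i (by simp) j (by simp) hij)
    obtain ⟨x, hx⟩ := exists_not_subsingleton_homotopyGroup m K hdown J hJK hproper
      (J.card - 1) (by omega) (by omega)
    exact hx (hsub x _ (by omega))

end FlagOfAspherical

section GreedyPaths

/-- The truncation of a real number to the interval `[-s, s]`. -/
def truncate (s c : ℝ) : ℝ := max (-s) (min s c)

theorem truncate_eq_self {s c : ℝ} (h : |c| ≤ s) : truncate s c = c := by
  rw [abs_le] at h
  rw [truncate, min_eq_right h.2, max_eq_right h.1]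

theorem abs_truncate_le {s c : ℝ} (hs : 0 ≤ s) : |truncate s c| ≤ s :=
  abs_le.2 ⟨le_max_left _ _, max_le (by linarith) (min_le_left _ _)⟩

theorem truncate_zero_left (c : ℝ) : truncate 0 c = 0 := by
  have := abs_truncate_le (c := c) le_rfl
  exact abs_nonpos_iff.1 this

theorem truncate_zero_right {s : ℝ} (hs : 0 ≤ s) : truncate s 0 = 0 :=
  truncate_eq_self (by simpa using hs)

theorem truncate_truncate {s r c : ℝ} (hs : 0 ≤ s) (hsr : s ≤ r) :
    truncate s (truncate r c) = truncate s c := by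
  unfold truncate
  rcases le_total r c with h1 | h1 <;> rcases le_total (-r) c with h2 | h2 <;>
  rcases le_total s c with h3 | h3 <;> rcases le_total (-s) c with h4 | h4 <;>
  simp only [min_def, max_def] <;> split_ifs <;> linarith

theorem abs_truncate_sub_truncate_le (s c d : ℝ) :
    |truncate s c - truncate s d| ≤ |c - d| := by
  unfold truncate
  calc _ ≤ max |-s - -s| |min s c - min s d| := abs_max_sub_max_le_max _ _ _ _
    _ = |min s c - min s d| := by simp
    _ ≤ max |s - s| |c - d| := abs_min_sub_min_le_max _ _ _ _
    _ = |c - d| := by simp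

theorem continuous_truncate : Continuous fun q : ℝ × ℝ => truncate q.1 q.2 := by
  unfold truncate
  fun_prop

variable {V : Type*} (N : V → V → Prop)

/-- A real number that is an integer. -/
def IsInteger (r : ℝ) : Prop := r ∈ Set.range ((↑) : ℤ → ℝ)

/-- Points of `ℝ^V` that have no two non-integral coordinates related by `N`. -/
abbrev EdgeSpace : Type _ :=
  { x : V → ℝ // ∀ v w, N v w → IsInteger (x v) ∨ IsInteger (x w) }

/-- A path in `EdgeSpace N` in which each coordinate moves towards its next value at unit speed as
soon as the coordinates related to it are at rest, and which reaches `x` from `p` in finite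
time. -/
structure IsGreedy (p x : V → ℝ) (u : ℝ → V → ℝ) : Prop where
  continuous : Continuous u
  start : ∀ t ≤ 0, u t = p
  arrives : ∃ T, ∀ t, T ≤ t → u t = x
  mem : ∀ t v w, N v w → IsInteger (u t v) ∨ IsInteger (u t w)
  greedy : ∀ v a b, 0 ≤ a → a ≤ b → (∀ w, N v w → ∀ t ∈ Set.Icc a b, u t w = u a w) →
    (∀ a', 0 ≤ a' → a' < a → ∃ w, N v w ∧ ∃ t ∈ Set.Icc a' a, u t w ≠ u a w) →
    ∀ t ∈ Set.Icc a b, u t v = u a v + truncate (t - a) (u b v - u a v)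

/-- Nonnegative times after which all coordinates related to `v` have reached their values
in `x`. -/
def settledTimes (u : ℝ → V → ℝ) (x : V → ℝ) (v : V) : Set ℝ :=
  {a | 0 ≤ a ∧ ∀ w, N v w → ∀ t, a ≤ t → u t w = x w}

/-- The first time after which all coordinates related to `v` have reached their values in `x`. -/
noncomputable def settleTime (u : ℝ → V → ℝ) (x : V → ℝ) (v : V) : ℝ := sInf (settledTimes N u x v)

/-- The path obtained from a greedy path `u` by moving its endpoint from `x` to `x'` so that it
remains greedy. -/
noncomputable def transport (u : ℝ → V → ℝ) (x x' : V → ℝ) (t : ℝ) (v : V) : ℝ :=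
  u (min t (settleTime N u x v)) v +
    truncate (max (t - settleTime N u x v) 0) (x' v - u (settleTime N u x v) v)

/-- Two points of which one is in the star of the other. -/
def Compatible (x x' : V → ℝ) : Prop :=
  ∀ v w, N v w → x v ≠ x' v → x w = x' w ∧ IsInteger (x w)

variable {N} {p x x' x'' : V → ℝ} {u : ℝ → V → ℝ} {v : V}

theorem Compatible.symm (h : Compatible N x x') : Compatible N x' x := fun v w hvw hne => by
  obtain ⟨h1, h2⟩ := h v w hvw hne.symm
  exact ⟨h1.symm, h1 ▸ h2⟩

theorem Compatible.refl (x : V → ℝ) : Compatible N x x := fun _ _ _ h => absurd rfl h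

theorem settledTimes_bddBelow : BddBelow (settledTimes N u x v) := ⟨0, fun _ ha => ha.1⟩

theorem settleTime_le {a : ℝ} (ha : a ∈ settledTimes N u x v) : settleTime N u x v ≤ a :=
  csInf_le settledTimes_bddBelow ha

theorem settleTime_nonneg : 0 ≤ settleTime N u x v := Real.sInf_nonneg fun _ ha => ha.1

theorem IsGreedy.settled (hu : IsGreedy N p x u) (v w : V) (hvw : N v w) (t : ℝ)
    (ht : settleTime N u x v ≤ t) : u t w = x w := by
  obtain ⟨T, hT⟩ := hu.arrives
  have hne : (settledTimes N u x v).Nonempty :=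
    ⟨max T 0, le_max_right _ _, fun w _ t ht => by rw [hT t ((le_max_left _ _).trans ht)]⟩
  have hlt : ∀ s, settleTime N u x v < s → u s w = x w := fun s hs => by
    obtain ⟨a, ha, has⟩ := (csInf_lt_iff settledTimes_bddBelow hne).1 hs
    exact ha.2 w hvw s has.le
  have hcl : IsClosed {s | u s w = x w} :=
    isClosed_eq ((continuous_apply w).comp hu.continuous) continuous_const
  have hsub : Set.Ioi (settleTime N u x v) ⊆ {s | u s w = x w} := hlt
  have := closure_minimal hsub hcl
  rw [closure_Ioi] at this
  exact this ht

theorem IsGreedy.apply_of_settleTime_le (hu : IsGreedy N p x u) (v : V) (t : ℝ)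
    (ht : settleTime N u x v ≤ t) :
    u t v = u (settleTime N u x v) v +
      truncate (t - settleTime N u x v) (x v - u (settleTime N u x v) v) := by
  obtain ⟨T, hT⟩ := hu.arrives
  have h := hu.greedy v (settleTime N u x v) (max t T) settleTime_nonneg
    (ht.trans (le_max_left _ _))
    (fun w hw s hs => by
      rw [hu.settled v w hw s hs.1, hu.settled v w hw _ le_rfl])
    (fun a ha hlt => by
      by_contra! hcon
      refine not_le.2 hlt (settleTime_le ⟨ha, fun w hw s hs => ?_⟩)
      rcases le_total s (settleTime N u x v) with h | h
      · rw [hcon w hw s ⟨hs, h⟩, hu.settled v w hw _ le_rfl]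
      · exact hu.settled v w hw s h)
    t ⟨ht, le_max_left _ _⟩
  rw [h, hT (max t T) (le_max_right _ _)]

theorem transport_of_le {t : ℝ} (ht : t ≤ settleTime N u x v) : transport N u x x' t v = u t v := by
  rw [transport, min_eq_left ht, max_eq_right (by linarith), truncate_zero_left, add_zero]

theorem transport_of_ge {t : ℝ} (ht : settleTime N u x v ≤ t) :
    transport N u x x' t v = u (settleTime N u x v) v +
      truncate (t - settleTime N u x v) (x' v - u (settleTime N u x v) v) := by
  rw [transport, min_eq_right ht, max_eq_left (by linarith)]

theorem IsGreedy.transport_of_eq (hu : IsGreedy N p x u) (h : x v = x' v) (t : ℝ) :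
    transport N u x x' t v = u t v := by
  rcases le_total t (settleTime N u x v) with ht | ht
  · exact transport_of_le ht
  · rw [transport_of_ge ht, hu.apply_of_settleTime_le v t ht, h]

theorem IsGreedy.transport_self (hu : IsGreedy N p x u) : transport N u x x = u :=
  funext fun t => funext fun _ => hu.transport_of_eq rfl t

theorem IsGreedy.abs_transport_sub_le (hu : IsGreedy N p x u) (x' : V → ℝ) (t : ℝ) (v : V) :
    |transport N u x x' t v - u t v| ≤ |x' v - x v| := by
  rcases le_total t (settleTime N u x v) with ht | ht
  · rw [transport_of_le ht]; simp
  · rw [transport_of_ge ht, hu.apply_of_settleTime_le v t ht]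
    refine le_trans (le_of_eq ?_) ((abs_truncate_sub_truncate_le (t - settleTime N u x v)
      (x' v - u (settleTime N u x v) v) (x v - u (settleTime N u x v) v)).trans (le_of_eq ?_))
    · congr 1; ring
    · congr 1; ring

theorem IsGreedy.transport_eq_of_le (hu : IsGreedy N p x u) {T : ℝ} (hT0 : 0 ≤ T)
    (hT : ∀ t, T ≤ t → u t = x) {x' : V → ℝ} {d : ℝ} (hd : ∀ v, |x' v - x v| ≤ d) (t : ℝ)
    (ht : T + d ≤ t) : transport N u x x' t = x' := by
  funext v
  have hd0 : 0 ≤ d := (abs_nonneg _).trans (hd v)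
  have hle : settleTime N u x v ≤ T :=
    settleTime_le ⟨hT0, fun w _ s hs => by rw [hT s hs]⟩
  have h1 := hu.apply_of_settleTime_le v T hle
  rw [hT T le_rfl] at h1
  have h2 : |x v - u (settleTime N u x v) v| ≤ T - settleTime N u x v := by
    have h3 : x v - u (settleTime N u x v) v =
      truncate (T - settleTime N u x v) (x v - u (settleTime N u x v) v) := by linarith
    rw [h3]
    exact abs_truncate_le (by linarith)
  rw [transport_of_ge (by linarith), truncate_eq_self]
  · ring
  · calc |x' v - u (settleTime N u x v) v| ≤ |x' v - x v| + |x v - u (settleTime N u x v) v| :=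
        abs_sub_le _ _ _
      _ ≤ t - settleTime N u x v := by linarith [hd v]

theorem settleTime_transport_eq (hu : IsGreedy N p x u) (h : ∀ w, N v w → x w = x' w) :
    settleTime N (transport N u x x') x' v = settleTime N u x v := by
  unfold settleTime settledTimes
  congr 1
  ext a
  refine and_congr_right fun _ => forall₂_congr fun w hw => forall₂_congr fun t _ => ?_
  rw [hu.transport_of_eq (h w hw), h w hw]

theorem IsGreedy.transport [Fintype V] (hN : ∀ ⦃v w⦄, N v w → N w v) (hu : IsGreedy N p x u)
    (hx : Compatible N x x') : IsGreedy N p x' (transport N u x x') where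
  continuous := by
    refine continuous_pi fun v => ?_
    have h1 : Continuous fun t => u t v := (continuous_apply v).comp hu.continuous
    exact (h1.comp (by fun_prop)).add
      (continuous_truncate.comp (by fun_prop : Continuous fun t =>
        ((max (t - settleTime N u x v) 0, x' v - u (settleTime N u x v) v) : ℝ × ℝ)))
  start t ht := by
    funext v
    rw [transport_of_le (ht.trans settleTime_nonneg), hu.start t ht]
  arrives := by
    obtain ⟨T, hT⟩ := hu.arrives
    exact ⟨max T 0 + ∑ v, |x' v - x v|, fun t ht =>
      hu.transport_eq_of_le (le_max_right _ _) (fun t ht => hT t ((le_max_left _ _).trans ht))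
        (fun v => Finset.single_le_sum (f := fun v => |x' v - x v|)
          (fun _ _ => abs_nonneg _) (Finset.mem_univ v)) t ht⟩
  mem := by
    have key : ∀ t v w, N v w → x v ≠ x' v →
        IsInteger (_root_.transport N u x x' t v) ∨ IsInteger (_root_.transport N u x x' t w) := by
      intro t v w hvw hne
      obtain ⟨h1, h2⟩ := hx v w hvw hne
      rcases le_total t (settleTime N u x v) with ht | ht
      · rw [transport_of_le ht, hu.transport_of_eq h1]
        exact hu.mem t v w hvw
      · right
        rwa [hu.transport_of_eq h1, hu.settled v w hvw t ht]
    intro t v w hvw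
    by_cases hv : x v = x' v
    · by_cases hw : x w = x' w
      · rw [hu.transport_of_eq hv, hu.transport_of_eq hw]
        exact hu.mem t v w hvw
      · exact (key t w v (hN hvw) hw).symm
    · exact key t v w hvw hv
  greedy := by
    intro v a b ha hab hconst hmin t ht
    by_cases hcase : ∀ w, N v w → x w = x' w
    · have hconst' : ∀ w, N v w → ∀ t ∈ Set.Icc a b, u t w = u a w := fun w hw s hs => by
        have := hconst w hw s hs
        rwa [hu.transport_of_eq (hcase w hw), hu.transport_of_eq (hcase w hw)] at this
      have hmin' : ∀ a', 0 ≤ a' → a' < a → ∃ w, N v w ∧ ∃ t ∈ Set.Icc a' a, u t w ≠ u a w := by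
        intro a' h0 hlt
        obtain ⟨w, hw, s, hs, hne⟩ := hmin a' h0 hlt
        refine ⟨w, hw, s, hs, ?_⟩
        rwa [hu.transport_of_eq (hcase w hw), hu.transport_of_eq (hcase w hw)] at hne
      rcases le_or_gt b (settleTime N u x v) with hb | hb
      · rw [transport_of_le (ht.2.trans hb), transport_of_le (hab.trans hb), transport_of_le hb]
        exact hu.greedy v a b ha hab hconst' hmin' t ht
      · have e1 : settleTime N u x v ≤ a := by
          refine settleTime_le ⟨ha, fun w hw s hs => ?_⟩
          rcases le_total s b with h | h
          · rw [hconst' w hw s ⟨hs, h⟩, ← hconst' w hw b ⟨hab, le_rfl⟩,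
              hu.settled v w hw b hb.le]
          · exact hu.settled v w hw s (hb.le.trans h)
        have e2 : a ≤ settleTime N u x v := by
          by_contra! hlt
          obtain ⟨w, hw, s, hs, hne⟩ := hmin' _ settleTime_nonneg hlt
          exact hne (by rw [hu.settled v w hw s hs.1, hu.settled v w hw a e1])
        have e3 := le_antisymm e1 e2
        rw [transport_of_ge (e1.trans ht.1), transport_of_ge e1, transport_of_ge hb.le, e3,
          sub_self, truncate_zero_left, add_zero, add_sub_cancel_left,
          truncate_truncate (by linarith [ht.1]) (by linarith [ht.2])]
    · push Not at hcase
      obtain ⟨w₀, hw₀, hne₀⟩ := hcase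
      have hv : x v = x' v := (hx w₀ v (hN hw₀) hne₀).1
      simp only [hu.transport_of_eq hv]
      classical
      obtain ⟨w₁, hw₁, hmin₁⟩ := Finset.exists_min_image
        (Finset.univ.filter fun w => N v w ∧ x w ≠ x' w) (fun w => settleTime N u x w)
        ⟨w₀, by simp [hw₀, hne₀]⟩
      simp only [Finset.mem_filter, Finset.mem_univ, true_and] at hw₁ hmin₁
      set s₁ := settleTime N u x w₁
      have hvconst : ∀ t, s₁ ≤ t → u t v = x v := hu.settled w₁ v (hN hw₁.1)
      have hsame : ∀ w, N v w → ∀ t, t ≤ s₁ → _root_.transport N u x x' t w = u t w := by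
        intro w hw t ht
        by_cases hxw : x w = x' w
        · exact hu.transport_of_eq hxw t
        · exact transport_of_le (ht.trans (hmin₁ w ⟨hw, hxw⟩))
      rcases le_or_gt s₁ a with h1 | h1
      · rw [hvconst t (h1.trans ht.1), hvconst a h1, hvconst b (h1.trans hab), sub_self,
          truncate_zero_right (by linarith [ht.1]), add_zero]
      have hmin' : ∀ a', 0 ≤ a' → a' < a → ∃ w, N v w ∧ ∃ t ∈ Set.Icc a' a, u t w ≠ u a w := by
        intro a' h0 hlt
        obtain ⟨w, hw, s, hs, hne⟩ := hmin a' h0 hlt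
        refine ⟨w, hw, s, hs, ?_⟩
        rwa [hsame w hw _ (hs.2.trans h1.le), hsame w hw _ h1.le] at hne
      have hg : ∀ c, a ≤ c → c ≤ b → c ≤ s₁ → ∀ t ∈ Set.Icc a c,
          u t v = u a v + truncate (t - a) (u c v - u a v) := by
        intro c hac hcb hcs
        refine hu.greedy v a c ha hac (fun w hw s hs => ?_) hmin'
        have := hconst w hw s ⟨hs.1, hs.2.trans hcb⟩
        rwa [hsame w hw _ (hs.2.trans hcs), hsame w hw _ h1.le] at this
      rcases le_or_gt b s₁ with h2 | h2
      · exact hg b hab le_rfl h2 t ht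
      · have h3 := hg s₁ h1.le h2.le le_rfl
        rw [hvconst s₁ le_rfl] at h3
        rw [hvconst b h2.le]
        rcases le_total t s₁ with h4 | h4
        · exact h3 t ⟨ht.1, h4⟩
        · have h5 := h3 s₁ ⟨h1.le, le_rfl⟩
          rw [hvconst s₁ le_rfl] at h5
          have h6 : |x v - u a v| ≤ s₁ - a := by
            have h7 : x v - u a v = truncate (s₁ - a) (x v - u a v) := by linarith
            rw [h7]
            exact abs_truncate_le (by linarith)
          rw [truncate_eq_self (by linarith), hvconst t h4]
          ring

theorem IsGreedy.transport_transport [Fintype V] (hN : ∀ ⦃v w⦄, N v w → N w v)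
    (hu : IsGreedy N p x u) (h1 : Compatible N x x') (h2 : Compatible N x' x'')
    (h3 : Compatible N x x'') :
    _root_.transport N (_root_.transport N u x x') x' x'' = _root_.transport N u x x'' := by
  funext t v
  by_cases hcase : ∀ w, N v w → x w = x' w
  · have h4 := settleTime_transport_eq hu hcase
    rw [_root_.transport, h4, transport_of_le (min_le_right _ _), transport_of_le le_rfl]
    rfl
  · push Not at hcase
    obtain ⟨w, hw, hne⟩ := hcase
    have e1 : x v = x' v := (h1 w v (hN hw) hne).1
    have e2 : x' v = x'' v := by
      by_contra hcon
      exact hne ((h3 v w hw (e1 ▸ hcon)).1.trans (h2 v w hw hcon).1.symm)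
    rw [(hu.transport hN h1).transport_of_eq e2, hu.transport_of_eq e1,
      hu.transport_of_eq (e1.trans e2)]

theorem isGreedy_const (hp : ∀ v w, N v w → IsInteger (p v) ∨ IsInteger (p w)) :
    IsGreedy N p p fun _ => p where
  continuous := continuous_const
  start _ _ := rfl
  arrives := ⟨0, fun _ _ => rfl⟩
  mem _ := hp
  greedy v a b _ _ _ _ t ht := by
    rw [sub_self, truncate_zero_right (by linarith [ht.1]), add_zero]

theorem eventually_not_isInteger (r : ℝ) :
    ∀ᶠ s in nhds r, s ≠ r → ¬ IsInteger s := by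
  have h := Int.isClosedEmbedding_coe_real.isClosedMap {k : ℤ | (k : ℝ) ≠ r} (isClosed_discrete _)
  have h2 : r ∈ (((↑) : ℤ → ℝ) '' {k : ℤ | (k : ℝ) ≠ r})ᶜ := by
    rintro ⟨k, hk, rfl⟩
    exact hk rfl
  filter_upwards [h.isOpen_compl.mem_nhds h2] with s hs hne
  rintro ⟨k, rfl⟩
  exact hs ⟨k, hne, rfl⟩

theorem eventually_compatible [Finite V] (x : EdgeSpace N) :
    ∀ᶠ x' in nhds x, Compatible N x.1 x'.1 := by
  have h : ∀ v, ∀ᶠ x' : EdgeSpace N in nhds x, x'.1 v ≠ x.1 v → ¬ IsInteger (x'.1 v) := fun v =>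
    (((continuous_apply v).comp continuous_subtype_val).tendsto x).eventually
      (eventually_not_isInteger (x.1 v))
  filter_upwards [Filter.eventually_all.2 h] with x' hx' v w hvw hne
  have h1 : IsInteger (x'.1 w) := (x'.2 v w hvw).resolve_left (hx' v hne.symm)
  have h2 : x'.1 w = x.1 w := by
    by_contra hcon
    exact hx' w hcon h1
  exact ⟨h2.symm, h2 ▸ h1⟩

end GreedyPaths

section GreedyCovering
open Filter
open scoped Topology

variable {V : Type*} (N : V → V → Prop) (p : V → ℝ)

/-- A greedy path starting at `p`, together with its endpoint. -/
@[ext]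
structure GreedyPath where
  /-- The endpoint. -/
  point : EdgeSpace N
  /-- The underlying path. -/
  path : ℝ → V → ℝ
  /-- The underlying path is greedy. -/
  isGreedy : IsGreedy N p point.1 path

variable {N p}

/-- The interior of the set of points compatible with a given point. -/
def compatibleNhd (x : EdgeSpace N) : Set (EdgeSpace N) :=
  interior {x' | Compatible N x.1 x'.1}

theorem compatible_of_mem {x x' : EdgeSpace N} (h : x' ∈ compatibleNhd x) :
    Compatible N x.1 x'.1 :=
  interior_subset h

theorem mem_compatibleNhd [Finite V] (x : EdgeSpace N) : x ∈ compatibleNhd x :=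
  mem_interior_iff_mem_nhds.2 (eventually_compatible x)

open Classical in
/-- The greedy path obtained by transport to a new endpoint, if that is possible. -/
noncomputable def GreedyPath.move [Fintype V] (hN : ∀ ⦃v w⦄, N v w → N w v)
    (q : GreedyPath N p) (x : EdgeSpace N) : GreedyPath N p :=
  if h : Compatible N q.point.1 x.1 then
    ⟨x, transport N q.path q.point.1 x.1, q.isGreedy.transport hN h⟩ else q

section Move

variable [Fintype V] (hN : ∀ ⦃v w⦄, N v w → N w v)

theorem GreedyPath.move_eq {q : GreedyPath N p} {x : EdgeSpace N}
    (h : Compatible N q.point.1 x.1) :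
    q.move hN x = ⟨x, transport N q.path q.point.1 x.1, q.isGreedy.transport hN h⟩ :=
  dif_pos h

theorem GreedyPath.point_move {q : GreedyPath N p} {x : EdgeSpace N}
    (h : Compatible N q.point.1 x.1) : (q.move hN x).point = x := by
  rw [q.move_eq hN h]

theorem GreedyPath.path_move {q : GreedyPath N p} {x : EdgeSpace N}
    (h : Compatible N q.point.1 x.1) :
    (q.move hN x).path = transport N q.path q.point.1 x.1 := by
  rw [q.move_eq hN h]

theorem GreedyPath.move_move {q : GreedyPath N p} {x x' : EdgeSpace N}
    (h1 : Compatible N q.point.1 x.1) (h2 : Compatible N x.1 x'.1)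
    (h3 : Compatible N q.point.1 x'.1) : (q.move hN x).move hN x' = q.move hN x' := by
  have h2' : Compatible N (q.move hN x).point.1 x'.1 := by rwa [q.point_move hN h1]
  refine GreedyPath.ext ?_ ?_
  · rw [GreedyPath.point_move hN h2', GreedyPath.point_move hN h3]
  · rw [GreedyPath.path_move hN h2', GreedyPath.path_move hN h3, q.path_move hN h1,
      q.point_move hN h1, q.isGreedy.transport_transport hN h1 h2 h3]

theorem GreedyPath.move_point (q : GreedyPath N p) : q.move hN q.point = q := by
  refine GreedyPath.ext ?_ ?_
  · rw [GreedyPath.point_move hN (Compatible.refl _)]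
  · rw [GreedyPath.path_move hN (Compatible.refl _), q.isGreedy.transport_self]

/-- The topology on greedy paths for which the endpoint map is a local homeomorphism with local
inverses given by transport. -/
@[reducible]
def GreedyPath.topology : TopologicalSpace (GreedyPath N p) where
  IsOpen s := ∀ q ∈ s, ∀ᶠ x in 𝓝 q.point, q.move hN x ∈ s
  isOpen_univ _ _ := Eventually.of_forall fun _ => trivial
  isOpen_inter s t hs ht q hq := (hs q hq.1).and (ht q hq.2)
  isOpen_sUnion S hS q := by
    rintro ⟨s, hs, hq⟩
    exact (hS s hs q hq).mono fun x hx => ⟨s, hs, hx⟩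

/-- The greedy paths ending at a given point. -/
def GreedyFiber (p : V → ℝ) (x : EdgeSpace N) : Type _ := { q : GreedyPath N p // q.point = x }

instance (x : EdgeSpace N) : TopologicalSpace (GreedyFiber p x) := ⊥

instance (x : EdgeSpace N) : DiscreteTopology (GreedyFiber p x) := ⟨rfl⟩

theorem GreedyPath.continuous_point :
    Continuous[GreedyPath.topology hN, _] (GreedyPath.point : GreedyPath N p → EdgeSpace N) := by
  let _ : TopologicalSpace (GreedyPath N p) := GreedyPath.topology hN
  refine continuous_def.2 fun s hs q hq => ?_
  filter_upwards [hs.mem_nhds hq, eventually_compatible q.point] with x hx hc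
  rwa [Set.mem_preimage, q.point_move hN hc]

theorem GreedyPath.isCoveringMap_point :
    @IsCoveringMap _ _ (GreedyPath.topology hN) _
      (GreedyPath.point : GreedyPath N p → EdgeSpace N) := by
  let _ : TopologicalSpace (GreedyPath N p) := GreedyPath.topology hN
  intro x
  refine IsEvenlyCovered.to_isEvenlyCovered_preimage (I := GreedyFiber p x) ⟨inferInstance, ?_⟩
  refine ⟨compatibleNhd x, mem_compatibleNhd x, isOpen_interior,
    isOpen_interior.preimage (GreedyPath.continuous_point hN), ?_⟩
  have hcomp : ∀ {x'}, x' ∈ compatibleNhd x → Compatible N x.1 x'.1 := compatible_of_mem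
  have hfib : ∀ (i : GreedyFiber p x) {x'}, x' ∈ compatibleNhd x →
      Compatible N i.1.point.1 x'.1 := fun i x' h => by rw [i.2]; exact hcomp h
  refine ⟨{
    toFun := fun q => (⟨q.1.point, q.2⟩, ⟨q.1.move hN x, q.1.point_move hN (hcomp q.2).symm⟩)
    invFun := fun r => ⟨r.2.1.move hN r.1.1, by
      rw [Set.mem_preimage, r.2.1.point_move hN (hfib r.2 r.1.2)]; exact r.1.2⟩
    left_inv := ?_
    right_inv := ?_
    continuous_toFun := ?_
    continuous_invFun := ?_ }, fun q => rfl⟩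
  · intro q
    refine Subtype.ext ?_
    change (q.1.move hN x).move hN q.1.point = q.1
    rw [GreedyPath.move_move hN (hcomp q.2).symm (hcomp q.2) (Compatible.refl _),
      GreedyPath.move_point]
  · rintro ⟨x', i⟩
    have h1 := hfib i x'.2
    refine Prod.ext (Subtype.ext (i.1.point_move hN h1)) (Subtype.ext ?_)
    change (i.1.move hN x'.1).move hN x = i.1
    have h2 : Compatible N i.1.point.1 x.1 := by rw [i.2]; exact Compatible.refl _
    rw [GreedyPath.move_move hN h1 (hcomp x'.2).symm h2]
    conv_rhs => rw [← GreedyPath.move_point hN i.1]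
    rw [i.2]
  · refine Continuous.prodMk (((GreedyPath.continuous_point hN).comp
      continuous_subtype_val).subtype_mk _) ?_
    refine (IsLocallyConstant.iff_exists_open _).2 ?_ |>.continuous
    intro q
    refine ⟨Subtype.val ⁻¹' {r : GreedyPath N p | r.point ∈ compatibleNhd x ∧
      r.move hN x = q.1.move hN x}, ?_, ⟨q.2, rfl⟩, fun r hr => Subtype.ext hr.2⟩
    refine IsOpen.preimage continuous_subtype_val ?_
    rintro r ⟨hr1, hr2⟩
    filter_upwards [isOpen_interior.mem_nhds hr1, eventually_compatible r.point] with x' hx' hc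
    refine ⟨by rwa [r.point_move hN hc], ?_⟩
    rw [← hr2, GreedyPath.move_move hN hc (hcomp hx').symm (hcomp hr1).symm]
  · refine Continuous.subtype_mk ?_ _
    refine continuous_prod_of_discrete_right.2 fun i => continuous_def.2 fun s hs => ?_
    refine isOpen_iff_mem_nhds.2 fun x' hx' => ?_
    have h1 := hs _ hx'
    rw [i.1.point_move hN (hfib i x'.2)] at h1
    rw [nhds_subtype_eq_comap]
    refine mem_comap.2 ⟨_, (h1.and (eventually_compatible x'.1)), ?_⟩
    rintro x'' ⟨h2, h3⟩
    rwa [GreedyPath.move_move hN (hfib i x'.2) h3 (hfib i x''.2)] at h2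

theorem GreedyPath.eventually_eq_move (q : GreedyPath N p) :
    letI : TopologicalSpace (GreedyPath N p) := GreedyPath.topology hN
    ∀ᶠ r in 𝓝 q, Compatible N q.point.1 r.point.1 ∧ r = q.move hN r.point := by
  let _ : TopologicalSpace (GreedyPath N p) := GreedyPath.topology hN
  refine mem_of_superset (IsOpen.mem_nhds (s := {r : GreedyPath N p |
    r.point ∈ compatibleNhd q.point ∧ r = q.move hN r.point}) ?_
    ⟨mem_compatibleNhd _, (q.move_point hN).symm⟩) fun r hr => ⟨compatible_of_mem hr.1, hr.2⟩
  rintro r ⟨hr1, hr2⟩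
  filter_upwards [isOpen_interior.mem_nhds hr1, eventually_compatible r.point] with x hx hc
  rw [r.point_move hN hc]
  refine ⟨hx, ?_⟩
  conv_lhs => rw [hr2]
  exact GreedyPath.move_move hN (compatible_of_mem hr1) hc (compatible_of_mem hx)

theorem GreedyPath.continuous_path :
    letI : TopologicalSpace (GreedyPath N p) := GreedyPath.topology hN
    Continuous fun r : ℝ × GreedyPath N p => r.2.path r.1 := by
  let _ : TopologicalSpace (GreedyPath N p) := GreedyPath.topology hN
  refine continuous_iff_continuousAt.2 fun ⟨t, q⟩ => ?_
  have h1 : Tendsto (fun r : ℝ × GreedyPath N p => q.path r.1) (𝓝 (t, q)) (𝓝 (q.path t)) :=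
    (q.isGreedy.continuous.comp continuous_fst).tendsto _
  have h2 : Tendsto (fun r : ℝ × GreedyPath N p => r.2.point.1 - q.point.1) (𝓝 (t, q)) (𝓝 0) := by
    have : Continuous fun r : ℝ × GreedyPath N p => r.2.point.1 - q.point.1 :=
      (continuous_subtype_val.comp ((GreedyPath.continuous_point hN).comp continuous_snd)).sub
        continuous_const
    simpa using this.tendsto (t, q)
  have h3 : Tendsto (fun r : ℝ × GreedyPath N p => r.2.path r.1 - q.path r.1)
      (𝓝 (t, q)) (𝓝 0) := by
    refine squeeze_zero_norm' ?_ (tendsto_zero_iff_norm_tendsto_zero.1 h2)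
    have h4 : ∀ᶠ r : ℝ × GreedyPath N p in 𝓝 (t, q),
        Compatible N q.point.1 r.2.point.1 ∧ r.2 = q.move hN r.2.point :=
      (continuous_snd.tendsto (t, q)).eventually (q.eventually_eq_move hN)
    filter_upwards [h4] with r hr
    refine (pi_norm_le_iff_of_nonneg (norm_nonneg _)).2 fun v => ?_
    refine le_trans ?_ (norm_le_pi_norm (r.2.point.1 - q.point.1) v)
    rw [hr.2, q.path_move hN hr.1, q.point_move hN hr.1]
    exact q.isGreedy.abs_transport_sub_le _ _ _
  have h5 := h1.add h3
  simp only [add_sub_cancel, add_zero] at h5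
  exact h5

theorem GreedyPath.exists_eventually_path_eq (q : GreedyPath N p) :
    letI : TopologicalSpace (GreedyPath N p) := GreedyPath.topology hN
    ∃ T, ∀ᶠ r : GreedyPath N p in 𝓝 q, ∀ t, T ≤ t → r.path t = r.point.1 := by
  let _ : TopologicalSpace (GreedyPath N p) := GreedyPath.topology hN
  obtain ⟨T, hT⟩ := q.isGreedy.arrives
  refine ⟨max T 0 + 1, ?_⟩
  have h1 : ∀ᶠ r : GreedyPath N p in 𝓝 q, dist r.point.1 q.point.1 < 1 :=
    ((continuous_subtype_val.comp (GreedyPath.continuous_point hN)).tendsto q).eventually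
      (Metric.ball_mem_nhds _ one_pos)
  filter_upwards [h1, q.eventually_eq_move hN] with r hr hr' t ht
  rw [hr'.2, q.path_move hN hr'.1, q.point_move hN hr'.1]
  refine q.isGreedy.transport_eq_of_le (le_max_right T 0)
    (fun t ht => hT t ((le_max_left _ _).trans ht)) (fun v => ?_) t ht
  exact (dist_le_pi_dist r.point.1 q.point.1 v).trans hr.le

theorem GreedyPath.exists_path_eq_of_compactSpace {A : Type*} [TopologicalSpace A] [CompactSpace A]
    {F : A → GreedyPath N p} (hF : Continuous[_, GreedyPath.topology hN] F) :
    ∃ T, ∀ a t, T ≤ t → (F a).path t = (F a).point.1 := by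
  let _ : TopologicalSpace (GreedyPath N p) := GreedyPath.topology hN
  have := isCompact_univ.induction_on
    (p := fun s : Set A => ∃ T, ∀ a ∈ s, ∀ t, T ≤ t → (F a).path t = (F a).point.1)
    ⟨0, fun _ h => h.elim⟩ (fun s t hst ⟨T, hT⟩ => ⟨T, fun a ha => hT a (hst ha)⟩)
    (fun s t ⟨T, hT⟩ ⟨T', hT'⟩ => ⟨max T T', fun a ha r hr => ha.elim
      (fun h => hT a h r ((le_max_left _ _).trans hr))
      (fun h => hT' a h r ((le_max_right _ _).trans hr))⟩)
    (fun a _ => by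
      obtain ⟨T, hT⟩ := (F a).exists_eventually_path_eq hN
      exact ⟨_, mem_nhdsWithin_of_mem_nhds ((hF.tendsto a).eventually hT), T, fun b hb => hb⟩)
  obtain ⟨T, hT⟩ := this
  exact ⟨T, fun a => hT a trivial⟩

end Move

end GreedyCovering

section AsphericalOfFlag
open unitInterval
open scoped Topology.Homotopy

/-- A map from a cube of dimension at least two that is constant on the boundary lifts along a
covering map to a map that is constant on the boundary. -/
theorem IsCoveringMap.exists_cube_lift {E X κ : Type*} [TopologicalSpace E] [TopologicalSpace X]
    [Nontrivial κ] {π : E → X} (hπ : IsCoveringMap π) (f : C(κ → I, X)) (e : E)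
    (hf : ∀ y ∈ Cube.boundary κ, f y = π e) :
    ∃ F : C(κ → I, E), (∀ y, π (F y) = f y) ∧ ∀ y ∈ Cube.boundary κ, F y = e := by
  classical
  obtain ⟨i₀⟩ := (inferInstance : Nonempty κ)
  have hf0 : f 0 = π e := hf 0 ⟨i₀, Or.inl rfl⟩
  let H : C(I × (κ → I), X) := ⟨fun q => f fun i => q.1 * q.2 i, by fun_prop⟩
  have hH : ∀ y, H (0, y) = π (ContinuousMap.const (κ → I) e y) := fun y => by
    change f (fun i => 0 * y i) = π e
    simp only [zero_mul]
    exact hf0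
  set L := hπ.liftHomotopy H (ContinuousMap.const _ e) hH
  have hlift : ∀ q, π (L q) = H q := fun q => congrFun (hπ.liftHomotopy_lifts H _ hH) q
  have hzero : ∀ y, L (0, y) = e := fun y => hπ.liftHomotopy_zero H _ hH y
  have hone : ∀ y, π (L (1, y)) = f y := fun y => by
    rw [hlift]
    change f (fun i => 1 * y i) = f y
    simp only [one_mul]
  have horigin : L (1, 0) = e := by
    rw [← hzero 0]
    refine hπ.const_of_comp (g := fun s : I => L (s, 0)) (by fun_prop) (fun s t => ?_) 1 0
    rw [hlift, hlift]
    change f (fun i => s * 0) = f (fun i => t * 0)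
    simp only [mul_zero]
  have hface : ∀ (i : κ) (c : I), c = 0 ∨ c = 1 → ∀ y y' : κ → I,
      L (1, Function.update y i c) = L (1, Function.update y' i c) := by
    intro i c hc y y'
    refine hπ.const_of_comp (g := fun y : κ → I => L (1, Function.update y i c)) ?_
      (fun y y' => ?_) y y'
    · exact L.continuous.comp (continuous_const.prodMk (continuous_id.update i continuous_const))
    · rw [hone, hone, hf _ ⟨i, by simpa using hc⟩, hf _ ⟨i, by simpa using hc⟩]
  have hface0 : ∀ (i : κ) (y : κ → I), y i = 0 → L (1, y) = e := by
    intro i y hy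
    have h1 := hface i 0 (Or.inl rfl) y 0
    rw [← hy, Function.update_eq_self, hy] at h1
    rw [h1, ← horigin]
    congr 2
    exact Function.update_eq_self i (0 : κ → I)
  refine ⟨⟨fun y => L (1, y), by fun_prop⟩, hone, ?_⟩
  rintro y ⟨i, hy | hy⟩
  · exact hface0 i y hy
  · have h1 := hface i 1 (Or.inr rfl) y 0
    have h2 : Function.update y i 1 = y := by rw [← hy, Function.update_eq_self]
    rw [h2] at h1
    obtain ⟨j, hj⟩ := exists_ne i
    change L (1, y) = e
    rw [h1]
    exact hface0 j _ (by rw [Function.update_of_ne hj]; rfl)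

/-- The universal covering of the circle with deck group `ℤ`. -/
noncomputable def circleExp (r : ℝ) : Circle := Circle.exp (2 * Real.pi * r)

theorem continuous_circleExp : Continuous circleExp :=
  Circle.exp.continuous.comp (by fun_prop)

theorem isCoveringMap_circleExp : IsCoveringMap circleExp :=
  Circle.isCoveringMap_exp.comp_homeomorph
    (Homeomorph.mulLeft₀ (2 * Real.pi) (by positivity))

theorem circleExp_eq_one_iff {r : ℝ} : circleExp r = 1 ↔ IsInteger r := by
  rw [circleExp, ← Circle.exp_zero, Circle.exp_eq_exp]
  refine exists_congr fun k => ?_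
  have := Real.pi_pos
  constructor
  · intro h
    have h1 : 2 * Real.pi * (r - k) = 0 := by linarith
    have h2 := (mul_eq_zero.1 h1).resolve_left (by positivity)
    linarith
  · rintro rfl
    ring

theorem surjective_circleExp : Function.Surjective circleExp := fun z => by
  refine ⟨Complex.arg z / (2 * Real.pi), ?_⟩
  rw [circleExp, mul_div_cancel₀ _ (by positivity)]
  exact Circle.exp_arg z

variable {m : ℕ} {K : Finset (Finset (Fin m))}

/-- Two distinct vertices that are not joined by an edge. -/
def NonAdjacent (K : Finset (Finset (Fin m))) (v w : Fin m) : Prop :=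
  v ≠ w ∧ ({v, w} : Finset (Fin m)) ∉ K

theorem NonAdjacent.symm ⦃v w : Fin m⦄ (h : NonAdjacent K v w) : NonAdjacent K w v :=
  ⟨h.1.symm, by rw [Finset.pair_comm]; exact h.2⟩

theorem exists_face_of_flag
    (hflag : ∀ J : Finset (Fin m),
      (∀ i ∈ J, ∀ j ∈ J, i ≠ j → ({i, j} : Finset (Fin m)) ∈ K) → J ∈ K)
    {x : Fin m → ℝ} (hx : ∀ v w, NonAdjacent K v w → IsInteger (x v) ∨ IsInteger (x w)) :
    ∃ L ∈ K, ∀ k, k ∉ L → circleExp (x k) = 1 := by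
  classical
  refine ⟨Finset.univ.filter fun k => ¬ IsInteger (x k), hflag _ fun i hi j hj hij => ?_,
    fun k hk => circleExp_eq_one_iff.2 (by simpa using hk)⟩
  by_contra hcon
  simp only [Finset.mem_filter, Finset.mem_univ, true_and] at hi hj
  exact (hx i j ⟨hij, hcon⟩).elim hi hj

theorem isInteger_or_isInteger_of_circleExp_mem (hdown : ∀ L ∈ K, ∀ J ⊆ L, J ∈ K)
    {x : Fin m → ℝ} (hx : ∃ L ∈ K, ∀ k, k ∉ L → circleExp (x k) = 1) (v w : Fin m)
    (hvw : NonAdjacent K v w) : IsInteger (x v) ∨ IsInteger (x w) := by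
  obtain ⟨L, hL, hLk⟩ := hx
  by_contra! hcon
  refine hvw.2 (hdown L hL _ fun k hk => ?_)
  by_contra hkL
  have h := circleExp_eq_one_iff.1 (hLk k hkL)
  rcases Finset.mem_insert.1 hk with rfl | hk
  · exact hcon.1 h
  · rw [Finset.mem_singleton.1 hk] at h
    exact hcon.2 h

theorem genLoop_homotopic_const (hdown : ∀ L ∈ K, ∀ J ⊆ L, J ∈ K)
    (hflag : ∀ J : Finset (Fin m),
      (∀ i ∈ J, ∀ j ∈ J, i ≠ j → ({i, j} : Finset (Fin m)) ∈ K) → J ∈ K)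
    (x : circlePolyhedralProduct m K) {κ : Type*} [Nontrivial κ]
    (f : GenLoop κ (circlePolyhedralProduct m K) x) :
    GenLoop.Homotopic f GenLoop.const := by
  choose p hp using fun k => surjective_circleExp (x.1 k)
  have hpm := isInteger_or_isInteger_of_circleExp_mem hdown (x := p)
    (by simpa only [hp] using x.2)
  have hcoord : ∀ k, ∃ F : C(κ → I, ℝ), (∀ y, circleExp (F y) = (f y).1 k) ∧
      ∀ y ∈ Cube.boundary κ, F y = p k := fun k =>
    isCoveringMap_circleExp.exists_cube_lift
      ⟨fun y => (f y).1 k, (continuous_apply k).comp (continuous_subtype_val.comp f.1.continuous)⟩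
      (p k) (fun y hy => by
        change (f y).1 k = _
        rw [GenLoop.boundary f y hy, hp])
  choose F hF hFb using hcoord
  let G : C(κ → I, EdgeSpace (NonAdjacent K)) := ⟨fun y => ⟨fun k => F k y,
    isInteger_or_isInteger_of_circleExp_mem hdown (by simpa only [hF] using (f y).2)⟩,
    by fun_prop⟩
  let _ : TopologicalSpace (GreedyPath (NonAdjacent K) p) := GreedyPath.topology NonAdjacent.symm
  obtain ⟨Q, hQ, hQb⟩ := (GreedyPath.isCoveringMap_point NonAdjacent.symm).exists_cube_lift
    G (⟨⟨p, hpm⟩, fun _ => p, isGreedy_const hpm⟩ : GreedyPath (NonAdjacent K) p)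
    (fun y hy => Subtype.ext (funext fun k => hFb k y hy))
  obtain ⟨T, hT⟩ := GreedyPath.exists_path_eq_of_compactSpace NonAdjacent.symm Q.continuous
  have hcont : Continuous fun q : I × (κ → I) => fun k =>
      circleExp ((Q q.2).path (T * (1 - (q.1 : ℝ))) k) := by
    refine continuous_pi fun k => continuous_circleExp.comp ((continuous_apply k).comp ?_)
    exact (GreedyPath.continuous_path NonAdjacent.symm).comp
      (Continuous.prodMk (f := fun q : I × (κ → I) => T * (1 - (q.1 : ℝ)))
        (by fun_prop) (Q.continuous.comp continuous_snd))
  have hfy : ∀ y k, circleExp ((Q y).point.1 k) = (f y).1 k := fun y k => by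
    rw [hQ]
    exact hF k y
  refine ⟨⟨⟨⟨fun q => ⟨_, exists_face_of_flag hflag
    ((Q q.2).isGreedy.mem (T * (1 - (q.1 : ℝ))))⟩, hcont.subtype_mk _⟩, fun y => ?_, fun y => ?_⟩,
    fun t y hy => ?_⟩⟩
  · refine Subtype.ext (funext fun k => ?_)
    change circleExp ((Q y).path (T * (1 - ((0 : I) : ℝ))) k) = (f y).1 k
    rw [hT y _ (by simp), hfy]
  · refine Subtype.ext (funext fun k => ?_)
    change circleExp ((Q y).path (T * (1 - ((1 : I) : ℝ))) k) = x.1 k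
    rw [(Q y).isGreedy.start _ (by simp), hp]
  · refine Subtype.ext (funext fun k => ?_)
    change circleExp ((Q y).path (T * (1 - (t : ℝ))) k) = (f y).1 k
    rw [hQb y hy, GenLoop.boundary f y hy, hp]

theorem pathConnectedSpace_circlePolyhedralProduct (hempty : (∅ : Finset (Fin m)) ∈ K) :
    PathConnectedSpace (circlePolyhedralProduct m K) := by
  let o : circlePolyhedralProduct m K := ⟨fun _ => 1, ∅, hempty, fun _ _ => rfl⟩
  have h : ∀ x : circlePolyhedralProduct m K, Joined o x := by
    rintro ⟨x, L, hL, hx⟩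
    have hmem : ∀ t : I, ∃ L ∈ K, ∀ k, k ∉ L → Circle.exp (t * Complex.arg (x k)) = 1 :=
      fun t => ⟨L, hL, fun k hk => by simp [hx k hk]⟩
    refine ⟨⟨⟨fun t => ⟨fun k => Circle.exp (t * Complex.arg (x k)), hmem t⟩,
      Continuous.subtype_mk (continuous_pi fun k => Circle.exp.continuous.comp (by fun_prop)) _⟩,
      Subtype.ext (funext fun k => ?_), Subtype.ext (funext fun k => ?_)⟩⟩
    · simp [o]
    · simp
  exact ⟨⟨o⟩, fun x y => (h x).symm.trans (h y)⟩

end AsphericalOfFlag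

/-- The polyhedral product `(S¹)^K` is aspherical (path-connected with trivial homotopy groups
`π_n` for all `n ≥ 2` and all basepoints) if and only if `K` is a flag complex. -/
theorem circle_polyhedral_product_aspherical_iff_flag (m : ℕ) (K : Finset (Finset (Fin m)))
    (hdown : ∀ I ∈ K, ∀ J ⊆ I, J ∈ K) (hempty : (∅ : Finset (Fin m)) ∈ K)
    (hsingle : ∀ i : Fin m, ({i} : Finset (Fin m)) ∈ K) :
    (PathConnectedSpace (circlePolyhedralProduct m K) ∧
        ∀ (x : circlePolyhedralProduct m K) (n : ℕ), 2 ≤ n →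
          Subsingleton (HomotopyGroup (Fin n) (circlePolyhedralProduct m K) x)) ↔
      (∀ J : Finset (Fin m),
        (∀ i ∈ J, ∀ j ∈ J, i ≠ j → ({i, j} : Finset (Fin m)) ∈ K) → J ∈ K) := by
  constructor
  · rintro ⟨-, hsub⟩
    exact flag_of_subsingleton_homotopyGroup m K hdown hempty hsingle hsub
  · intro hflag
    refine ⟨pathConnectedSpace_circlePolyhedralProduct hempty, fun x n hn => ⟨fun a b => ?_⟩⟩
    have : Nontrivial (Fin n) := Fin.nontrivial_iff_two_le.2 hn
    induction a using Quotient.inductionOn with | h f =>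
    induction b using Quotient.inductionOn with | h g =>
    exact Quotient.sound ((genLoop_homotopic_const hdown hflag x f).trans
      (genLoop_homotopic_const hdown hflag x g).symm)
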